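/- Fix μ > 0, γ > 0 and n ≥ 1. Define the composed density recursively by q₁(x,t) = Q(x;t,μ,γ) and q_{k+1}(x,t) = ∫₀^∞ q_k(x,s) Q(s;t,μ,1) ds for 1 ≤ k ≤ n−1, corresponding to the iterated process G¹_γ(G²₁(…(Gⁿ₁(t))…)). Then for every t > 0 and every real η with (η−1)/γ + μ > 0, one has ∫₀^∞ x^(η−1) q_n(x,t) dx = ( Γ((η−1)/γ + μ) / Γ(μ) )^n · t^((η−1)/γ) = ( ∫₀^∞ x^(η−1) Q(x; t^(1/n), μ, γ) dx )^n; hence G¹_γ(G²₁(…(Gⁿ₁(t))…)) has the same distribution as the product ∏_{j=1}^n Gʲ_γ(t^(1/n)) of n independent generalized Gamma processes. -/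

import Mathlib

open MeasureTheory

/-- The generalized Gamma density `Q(x;t,μ,γ) = γ x^(γμ−1) e^(−x^γ/t) / (t^μ Γ(μ))`. -/
noncomputable def Q (x t μ γ : ℝ) : ℝ :=
  γ * x ^ (γ * μ - 1) * Real.exp (-(x ^ γ) / t) / (t ^ μ * Real.Gamma μ)

/-- The composed density of `G¹_γ(G²₁(…(Gⁿ₁(t))…))`:
`q₁(x,t) = Q(x;t,μ,γ)` and `q_{k+1}(x,t) = ∫₀^∞ q_k(x,s) Q(s;t,μ,1) ds`. -/
noncomputable def qG (μ γ : ℝ) : ℕ → ℝ → ℝ → ℝ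
  | 0 => fun x t => Q x t μ γ
  | (k + 1) => fun x t => ∫ s in Set.Ioi (0:ℝ), qG μ γ k x s * Q s t μ 1

theorem Q_nonneg {x t μ γ : ℝ} (hx : 0 ≤ x) (ht : 0 ≤ t) (hμ : 0 < μ) (hγ : 0 ≤ γ) :
    0 ≤ Q x t μ γ := by
  have := Real.Gamma_pos_of_pos hμ
  unfold Q
  positivity

theorem measurable_Q (μ γ : ℝ) : Measurable fun p : ℝ × ℝ => Q p.1 p.2 μ γ := by
  unfold Q
  fun_prop

theorem rpow_mul_Q {μ γ t a x : ℝ} (hx : 0 < x) :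
    x ^ a * Q x t μ γ = γ / (t ^ μ * Real.Gamma μ) *
      (x ^ (a + γ * μ - 1) * Real.exp (-t⁻¹ * x ^ γ)) := by
  rw [Q, add_sub_assoc, Real.rpow_add hx, show -(x ^ γ) / t = -t⁻¹ * x ^ γ by ring]
  ring

theorem integrableOn_rpow_mul_Q {μ γ t a : ℝ} (hγ : 0 < γ) (ht : 0 < t)
    (ha : 0 < a / γ + μ) :
    IntegrableOn (fun x => x ^ a * Q x t μ γ) (Set.Ioi 0) := by
  have hq : 0 < a + γ * μ := by
    have := mul_pos hγ ha
    rwa [mul_add, mul_div_cancel₀ _ hγ.ne'] at this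
  refine IntegrableOn.congr_fun ((integrableOn_rpow_mul_exp_neg_mul_rpow
    (s := a + γ * μ - 1) (by linarith) hγ (inv_pos.2 ht)).const_mul _)
    (fun x hx => (rpow_mul_Q hx).symm) measurableSet_Ioi

theorem integral_rpow_mul_Q {μ γ t a : ℝ} (hγ : 0 < γ) (ht : 0 < t)
    (ha : 0 < a / γ + μ) :
    ∫ x in Set.Ioi (0:ℝ), x ^ a * Q x t μ γ
      = Real.Gamma (a / γ + μ) / Real.Gamma μ * t ^ (a / γ) := by
  have hq : 0 < a + γ * μ := by
    have := mul_pos hγ ha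
    rwa [mul_add, mul_div_cancel₀ _ hγ.ne'] at this
  rw [setIntegral_congr_fun measurableSet_Ioi fun x hx => rpow_mul_Q hx, integral_const_mul,
    integral_rpow_mul_exp_neg_mul_rpow hγ (by linarith) (inv_pos.2 ht), sub_add_cancel, neg_div,
    show (a + γ * μ) / γ = a / γ + μ by field_simp, Real.inv_rpow ht.le, Real.rpow_neg ht.le,
    inv_inv, Real.rpow_add ht]
  have := (Real.rpow_pos_of_pos ht μ).ne'
  field_simp

theorem qG_nonneg {μ γ x t : ℝ} (hμ : 0 < μ) (hγ : 0 ≤ γ) (hx : 0 ≤ x) (ht : 0 ≤ t) (k : ℕ) :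
    0 ≤ qG μ γ k x t := by
  induction k generalizing t with
  | zero => exact Q_nonneg hx ht hμ hγ
  | succ k ih =>
    exact setIntegral_nonneg measurableSet_Ioi fun s hs =>
      mul_nonneg (ih (le_of_lt hs)) (Q_nonneg (le_of_lt hs) ht hμ zero_le_one)

theorem measurable_qG (μ γ : ℝ) (k : ℕ) : Measurable fun p : ℝ × ℝ => qG μ γ k p.1 p.2 := by
  induction k with
  | zero => exact measurable_Q μ γ
  | succ k ih =>
    have h : Measurable fun p : (ℝ × ℝ) × ℝ => qG μ γ k p.1.1 p.2 * Q p.2 p.1.2 μ 1 :=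
      (ih.comp (measurable_fst.fst.prodMk measurable_snd)).mul
        ((measurable_Q μ 1).comp (measurable_snd.prodMk measurable_fst.snd))
    exact h.stronglyMeasurable.integral_prod_right'.measurable

theorem mellin_qG {μ γ a : ℝ} (hμ : 0 < μ) (hγ : 0 < γ) (ha : 0 < a / γ + μ) (k : ℕ)
    {t : ℝ} (ht : 0 < t) :
    IntegrableOn (fun x => x ^ a * qG μ γ k x t) (Set.Ioi 0) ∧
      ∫ x in Set.Ioi (0:ℝ), x ^ a * qG μ γ k x t
        = (Real.Gamma (a / γ + μ) / Real.Gamma μ) ^ (k + 1) * t ^ (a / γ) := by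
  induction k generalizing t with
  | zero =>
    rw [zero_add, pow_one]
    exact ⟨integrableOn_rpow_mul_Q hγ ht ha, integral_rpow_mul_Q hγ ht ha⟩
  | succ k ih =>
    set c := Real.Gamma (a / γ + μ) / Real.Gamma μ
    let F : ℝ → ℝ → ℝ := fun x s => x ^ a * (qG μ γ k x s * Q s t μ 1)
    have ha' : 0 < a / γ / 1 + μ := by rwa [div_one]
    have hFm : Measurable (Function.uncurry F) :=
      (measurable_fst.pow_const a).mul ((measurable_qG μ γ k).mul
        ((measurable_Q μ 1).comp (measurable_snd.prodMk measurable_const)))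
    have hFint : ∀ s ∈ Set.Ioi (0:ℝ), ∫ x in Set.Ioi (0:ℝ), F x s
        = c ^ (k + 1) * (s ^ (a / γ) * Q s t μ 1) := by
      intro s hs
      simp only [F, ← mul_assoc]
      rw [integral_mul_const, (ih hs).2]
    have hnorm : ∀ s ∈ Set.Ioi (0:ℝ), ∫ x in Set.Ioi (0:ℝ), ‖F x s‖
        = c ^ (k + 1) * (s ^ (a / γ) * Q s t μ 1) := by
      intro s hs
      rw [← hFint s hs]
      refine setIntegral_congr_fun measurableSet_Ioi fun x hx => Real.norm_of_nonneg ?_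
      exact mul_nonneg (Real.rpow_nonneg (le_of_lt hx) _)
        (mul_nonneg (qG_nonneg hμ hγ.le (le_of_lt hx) (le_of_lt hs) k)
          (Q_nonneg (le_of_lt hs) ht.le hμ zero_le_one))
    have hF : Integrable (Function.uncurry F)
        ((volume.restrict (Set.Ioi 0)).prod (volume.restrict (Set.Ioi 0))) := by
      refine (integrable_prod_iff' hFm.aestronglyMeasurable).2 ⟨?_, ?_⟩
      · refine ae_restrict_of_forall_mem measurableSet_Ioi fun s hs => ?_
        simpa only [F, Function.uncurry, ← mul_assoc] using (ih hs).1.mul_const (Q s t μ 1)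
      · exact IntegrableOn.congr_fun
          ((integrableOn_rpow_mul_Q one_pos ht ha').const_mul (c ^ (k + 1)))
          (fun s hs => (hnorm s hs).symm) measurableSet_Ioi
    have hstep : (fun x => x ^ a * qG μ γ (k + 1) x t)
        = fun x => ∫ s in Set.Ioi (0:ℝ), F x s :=
      funext fun x => (integral_const_mul _ _).symm
    rw [hstep]
    refine ⟨hF.integral_prod_left, ?_⟩
    rw [integral_integral_swap hF, setIntegral_congr_fun measurableSet_Ioi hFint,
      integral_const_mul, integral_rpow_mul_Q one_pos ht ha', div_one, pow_succ c (k + 1),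
      mul_assoc]

/-- the Mellin transform of the density of `G¹_γ(G²₁(…(Gⁿ₁(t))…))` is
`(Γ((η−1)/γ + μ)/Γ(μ))ⁿ t^((η−1)/γ)`, the `n`-th power of the Mellin transform of
`Q(·;t^(1/n),μ,γ)`; hence the iterated process is distributed as `∏ⱼ Gʲ_γ(t^(1/n))`. -/
theorem stmt_10 (μ γ : ℝ) (hμ : 0 < μ) (hγ : 0 < γ) (n : ℕ) (hn : 1 ≤ n)
    (t η : ℝ) (ht : 0 < t) (hη : 0 < (η - 1) / γ + μ) :
    (∫ x in Set.Ioi (0:ℝ), x ^ (η - 1) * qG μ γ (n - 1) x t)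
      = (Real.Gamma ((η - 1) / γ + μ) / Real.Gamma μ) ^ n * t ^ ((η - 1) / γ)
    ∧ (∫ x in Set.Ioi (0:ℝ), x ^ (η - 1) * qG μ γ (n - 1) x t)
        = (∫ x in Set.Ioi (0:ℝ), x ^ (η - 1) * Q x (t ^ ((1:ℝ) / n)) μ γ) ^ n := by
  obtain ⟨k, rfl⟩ := Nat.exists_eq_add_of_le' hn
  have h := (mellin_qG hμ hγ hη k ht).2
  rw [Nat.add_sub_cancel]
  refine ⟨h, h.trans ?_⟩
  rw [integral_rpow_mul_Q hγ (Real.rpow_pos_of_pos ht _) hη, mul_pow, ← Real.rpow_natCast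
    ((t ^ _) ^ _), ← Real.rpow_mul ht.le, ← Real.rpow_mul ht.le]
  congr 2
  field_simp
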